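/- For the boundary driven Kawasaki process on 𝒢_N with N ≥ 5 and parameters satisfying μ_L > κ > 0 > μ_R and |μ_R| > κ: for every x ∈ 𝒫 the set 𝒜_x consisting of x together with all its preferred successors is an attractor, and 𝒜_x ∩ 𝒜_y = ∅ for distinct x, y ∈ 𝒫. -/

import Mathlib

open scoped Classical

namespace Kawasaki

/-- Configurations of the lattice gas on `{1,…,N}`: each site is occupied (`true`) or empty. -/
abbrev Config (N : ℕ) := Fin N → Bool

/-- Occupation number of site `i` as a real number. -/
noncomputable def occ {N : ℕ} (x : Config N) (i : Fin N) : ℝ := if x i then 1 else 0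

/-- The nearest-neighbour interaction energy `E(x) = -κ ∑ x(i) x(i+1)`. -/
noncomputable def energy {N : ℕ} (κ : ℝ) (x : Config N) : ℝ :=
  -κ * ∑ i : Fin N, ∑ j : Fin N, if (j : ℕ) = (i : ℕ) + 1 then occ x i * occ x j else 0

/-- `x^{i,j}`: the configuration with the occupations of `i` and `j` interchanged. -/
def swapConf {N : ℕ} (x : Config N) (i j : Fin N) : Config N :=
  Function.update (Function.update x i (x j)) j (x i)

/-- `x^i`: the configuration with the occupation at `i` flipped. -/
def flipConf {N : ℕ} (x : Config N) (i : Fin N) : Config N :=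
  Function.update x i (!x i)

/-- The last site. -/
def lastIdx (N : ℕ) [NeZero N] : Fin N :=
  ⟨N - 1, Nat.sub_lt (Nat.pos_of_ne_zero (NeZero.ne N)) Nat.one_pos⟩

/-- `y` is obtained from `x` by exchanging the occupations of two nearest neighbours. -/
def IsSwap {N : ℕ} (x y : Config N) : Prop :=
  ∃ i j : Fin N, (j : ℕ) = (i : ℕ) + 1 ∧ y = swapConf x i j

/-- The allowed transitions: nearest-neighbour exchanges in the bulk,
birth/death at the two boundary sites. -/
def Allowed {N : ℕ} [NeZero N] (x y : Config N) : Prop :=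
  y ≠ x ∧ (IsSwap x y ∨ y = flipConf x 0 ∨ y = flipConf x (lastIdx N))

/-- The transition rates of the boundary driven Kawasaki process at inverse temperature `β`. -/
noncomputable def rate {N : ℕ} [NeZero N] (κ μL μR β : ℝ) (x y : Config N) : ℝ :=
  if y = x then 0
  else if IsSwap x y then Real.exp (-(β / 2) * (energy κ y - energy κ x))
  else if y = flipConf x 0 then
    Real.exp (β * μL / 2 * (1 - 2 * occ x 0)) *
      Real.exp (-(β / 2) * (energy κ y - energy κ x))
  else if y = flipConf x (lastIdx N) then
    Real.exp (β * μR / 2 * (1 - 2 * occ x (lastIdx N))) *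
      Real.exp (-(β / 2) * (energy κ y - energy κ x))
  else 0

/-- `ρ` is a stationary probability distribution for the rates at inverse temperature `β`. -/
noncomputable def IsStationary {N : ℕ} [NeZero N] (κ μL μR β : ℝ) (ρ : Config N → ℝ) : Prop :=
  (∀ x, 0 ≤ ρ x) ∧ (∑ x, ρ x = 1) ∧
  ∀ x, ∑ y, ρ y * rate κ μL μR β y x = ρ x * ∑ y, rate κ μL μR β x y

/-- `φ(x,y) = lim_{β→∞} (1/β) log k(x→y;β)` (computed explicitly, the rates being
pure exponentials in `β`). -/
noncomputable def phi {N : ℕ} [NeZero N] (κ μL μR : ℝ) (x y : Config N) : ℝ :=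
  if IsSwap x y then -(energy κ y - energy κ x) / 2
  else if y = flipConf x 0 then
    μL * (1 - 2 * occ x 0) / 2 - (energy κ y - energy κ x) / 2
  else if y = flipConf x (lastIdx N) then
    μR * (1 - 2 * occ x (lastIdx N)) / 2 - (energy κ y - energy κ x) / 2
  else 0

/-- `Γ(x) = -max_y φ(x,y)` (maximum over the allowed transitions from `x`). -/
noncomputable def Gam {N : ℕ} [NeZero N] (κ μL μR : ℝ) (x : Config N) : ℝ :=
  - sSup (phi κ μL μR x '' {y | Allowed x y})

/-- `U(x,y) = -φ(x,y) - Γ(x)` (meaningful on allowed transitions). -/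
noncomputable def Ucost {N : ℕ} [NeZero N] (κ μL μR : ℝ) (x y : Config N) : ℝ :=
  - phi κ μL μR x y - Gam κ μL μR x

/-- The cost `U(D)` of a path: sum of `U` over consecutive steps. -/
noncomputable def pathCost {N : ℕ} [NeZero N] (κ μL μR : ℝ) : List (Config N) → ℝ
  | [] => 0
  | [_] => 0
  | a :: b :: l => Ucost κ μL μR a b + pathCost κ μL μR (b :: l)

/-- `𝒰(x,y)`: the minimal cost over all paths of allowed transitions from `x` to `y`. -/
noncomputable def Ucal {N : ℕ} [NeZero N] (κ μL μR : ℝ) (x y : Config N) : ℝ :=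
  sInf { c | ∃ L : List (Config N), L.Chain' Allowed ∧ L.head? = some x ∧
    L.getLast? = some y ∧ c = pathCost κ μL μR L }

/-- `t` encodes a spanning tree of the transition graph with all edges oriented toward `x`:
`t y` is the successor of `y` on the unique path from `y` to the root `x`. -/
def IsInTree {N : ℕ} [NeZero N] (t : Config N → Config N) (x : Config N) : Prop :=
  t x = x ∧ (∀ y, y ≠ x → Allowed y (t y)) ∧ ∀ y, ∃ n : ℕ, t^[n] y = x

/-- `U(𝒯_x)`: the sum of `U` over all (oriented) edges of the in-tree. -/
noncomputable def treeCost {N : ℕ} [NeZero N] (κ μL μR : ℝ) (t : Config N → Config N)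
    (x : Config N) : ℝ :=
  ∑ y : Config N, if y = x then 0 else Ucost κ μL μR y (t y)

/-- `Θ(x) = min_𝒯 U(𝒯_x)`. -/
noncomputable def Theta {N : ℕ} [NeZero N] (κ μL μR : ℝ) (x : Config N) : ℝ :=
  sInf { c | ∃ t, IsInTree t x ∧ c = treeCost κ μL μR t x }

/-- `Ψ = Γ - Θ`. -/
noncomputable def Psi {N : ℕ} [NeZero N] (κ μL μR : ℝ) (x : Config N) : ℝ :=
  Gam κ μL μR x - Theta κ μL μR x

/-- `η_{p,q}`: `p` occupied sites followed by `q = N - p` empty sites. -/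
def eta (N p : ℕ) : Config N := fun i => decide ((i : ℕ) < p)

/-- `x ∈ 𝒟` iff `x = η_{p,q}` with `p ≥ 3`, `q ≥ 2`, `p + q = N`. -/
def memD {N : ℕ} (x : Config N) : Prop :=
  ∃ p q : ℕ, 3 ≤ p ∧ 2 ≤ q ∧ p + q = N ∧ x = eta N p

/-- The configuration written in block form `(p_0,q_0,…,p_n,q_n)`:
`p_0` occupied sites, then `q_0` empty sites, and so on. -/
def blockConfig (ps qs : List ℕ) : List Bool :=
  (ps.zip qs).flatMap fun pq => List.replicate pq.1 true ++ List.replicate pq.2 false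

/-- `x ∈ 𝒫`: block form `(p_0,q_0,…,p_n,q_n)` with all `p_i ≥ 3`,
`q_i ≥ 3` for `i < n` and `q_n ≥ 2`. -/
def memP {N : ℕ} (x : Config N) : Prop :=
  ∃ ps qs : List ℕ, ps.length = qs.length ∧ 0 < ps.length ∧
    (∀ p ∈ ps, 3 ≤ p) ∧ (∀ q ∈ qs.dropLast, 3 ≤ q) ∧ (∀ q ∈ qs.getLast?, 2 ≤ q) ∧
    List.ofFn x = blockConfig ps qs

/-- `y` is obtained from `x` by one occupation switch of the form
`…11100… → …11010…` or `…00111… → …01011…`. -/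
def isSwitchE {N : ℕ} (x y : Config N) : Prop :=
  (∃ a : ℕ, ∃ h : a + 4 < N,
    x ⟨a, by omega⟩ = true ∧ x ⟨a + 1, by omega⟩ = true ∧ x ⟨a + 2, by omega⟩ = true ∧
    x ⟨a + 3, by omega⟩ = false ∧ x ⟨a + 4, by omega⟩ = false ∧
    y = swapConf x ⟨a + 2, by omega⟩ ⟨a + 3, by omega⟩) ∨
  (∃ a : ℕ, ∃ h : a + 4 < N,
    x ⟨a, by omega⟩ = false ∧ x ⟨a + 1, by omega⟩ = false ∧ x ⟨a + 2, by omega⟩ = true ∧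
    x ⟨a + 3, by omega⟩ = true ∧ x ⟨a + 4, by omega⟩ = true ∧
    y = swapConf x ⟨a + 1, by omega⟩ ⟨a + 2, by omega⟩)

/-- `y ∈ ℰ`: obtained from some `x ∈ 𝒫` by one such switch. -/
def memE {N : ℕ} (y : Config N) : Prop := ∃ x : Config N, memP x ∧ isSwitchE x y

/-- `y` is a preferred successor of `x`: an allowed transition with `U(x,y) = 0`. -/
def PreferredStep {N : ℕ} [NeZero N] (κ μL μR : ℝ) (x y : Config N) : Prop :=
  Allowed x y ∧ Ucost κ μL μR x y = 0

/-- `𝒜_x`: the set consisting of `x` together with all its preferred successors. -/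
def Attr {N : ℕ} [NeZero N] (κ μL μR : ℝ) (x : Config N) : Set (Config N) :=
  insert x {y | PreferredStep κ μL μR x y}

/-- A nonempty set `A` is an attractor when `𝒰 = 0` inside `A` and `𝒰 > 0` from `A`
to its complement. -/
def IsAttractor {N : ℕ} [NeZero N] (κ μL μR : ℝ) (A : Set (Config N)) : Prop :=
  A.Nonempty ∧ (∀ x ∈ A, ∀ y ∈ A, x ≠ y → Ucal κ μL μR x y = 0) ∧
  ∀ x ∈ A, ∀ y, y ∉ A → 0 < Ucal κ μL μR x y

end Kawasaki

namespace Kawasaki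

variable {N : ℕ}

/-- The occupations of `x` as a function on `ℕ`, with sites numbered from `1` and
empty sites outside `{1,…,N}`. -/
def ext (x : Config N) : ℕ → Bool
  | 0 => false
  | m + 1 => if h : m < N then x ⟨m, h⟩ else false

/-- The real-valued occupations of `x` on `ℕ`, with sites numbered from `1`. -/
noncomputable def rocc (x : Config N) (m : ℕ) : ℝ := if ext x m then 1 else 0

lemma ext_succ (x : Config N) (k : Fin N) : ext x (k + 1) = x k := by
  simp [ext]

lemma ext_of_lt (x : Config N) {m : ℕ} (hm : N < m) : ext x m = false := by
  obtain ⟨m, rfl⟩ := Nat.exists_eq_succ_of_ne_zero (by omega : m ≠ 0)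
  simp [ext, show ¬ m < N by omega]

lemma ext_injective : Function.Injective (ext (N := N)) := by
  intro x y h
  funext k
  rw [← ext_succ x k, ← ext_succ y k, h]

lemma ext_update (x : Config N) (k : Fin N) (b : Bool) :
    ext (Function.update x k b) = Function.update (ext x) (k + 1) b := by
  funext m
  cases m with
  | zero => simp [ext]
  | succ m =>
    by_cases h : m < N
    · by_cases hk : m = k
      · subst hk; simp [ext]
      · have : (⟨m, h⟩ : Fin N) ≠ k := by
          rintro rfl; exact hk rfl
        simp [ext, h, hk, this]
    · have hk : m ≠ k := by rintro rfl; exact h k.2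
      simp [ext, h, hk]

lemma ext_swapConf (x : Config N) (i j : Fin N) (hij : (j : ℕ) = i + 1) (m : ℕ) :
    ext (swapConf x i j) m =
      if m = i + 1 then ext x (i + 2) else if m = i + 2 then ext x (i + 1) else ext x m := by
  have hj : ext x (i + 2) = x j := by rw [← ext_succ x j, hij]
  rw [swapConf, ext_update, ext_update, hj, ext_succ]
  simp only [Function.update_apply, hij]
  grind

lemma swapConf_eq_self {x : Config N} {i j : Fin N} (hij : (j : ℕ) = i + 1)
    (h : ext x (i + 1) = ext x (i + 2)) : swapConf x i j = x := by
  apply ext_injective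
  funext m
  rw [ext_swapConf x i j hij]
  grind

lemma swapConf_swapConf (x : Config N) {i j : Fin N} (hij : (j : ℕ) = i + 1) :
    swapConf (swapConf x i j) i j = x := by
  apply ext_injective
  funext m
  simp only [ext_swapConf _ i j hij]
  grind

lemma sum_mul_succ_update (f : ℕ → ℝ) (n k : ℕ) (hk : k + 1 < n) (v : ℝ) :
    ∑ m ∈ Finset.range n,
      Function.update f (k + 1) v m * Function.update f (k + 1) v (m + 1) =
    ∑ m ∈ Finset.range n, f m * f (m + 1) + (v - f (k + 1)) * (f k + f (k + 2)) := by
  have h : ∀ m, Function.update f (k + 1) v m * Function.update f (k + 1) v (m + 1) =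
      f m * f (m + 1) + ((if m = k then (v - f (k + 1)) * f k else 0) +
        if m = k + 1 then (v - f (k + 1)) * f (k + 2) else 0) := by
    intro m
    by_cases h1 : m = k
    · subst h1; simp; ring
    · by_cases h2 : m = k + 1
      · subst h2; simp; ring
      · simp [h1, h2]
  rw [Finset.sum_congr rfl fun m _ => h m, Finset.sum_add_distrib, Finset.sum_add_distrib,
    Finset.sum_ite_eq', Finset.sum_ite_eq']
  simp only [Finset.mem_range, hk, show k < n by omega, if_true]
  ring

lemma energy_eq (κ : ℝ) (x : Config N) :
    energy κ x = -κ * ∑ m ∈ Finset.range (N + 1), rocc x m * rocc x (m + 1) := by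
  rw [energy, Finset.sum_range_succ', Finset.sum_range]
  congr 1
  have h0 : rocc x 0 = 0 := by simp [rocc, ext]
  rw [h0, zero_mul, add_zero]
  refine Finset.sum_congr rfl fun i _ => ?_
  have hocc : ∀ k : Fin N, rocc x (k + 1) = occ x k := fun k => by
    rw [rocc, ext_succ, occ]
  by_cases hi : (i : ℕ) + 1 < N
  · rw [Finset.sum_eq_single ⟨i + 1, hi⟩]
    · rw [if_pos rfl, ← hocc, ← hocc]
    · intro j _ hj
      rw [if_neg]
      intro h
      exact hj (Fin.ext h)
    · simp
  · have : rocc x (i + 1 + 1) = 0 := by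
      rw [rocc, ext_of_lt x (by omega)]; simp
    rw [this, mul_zero]
    refine Finset.sum_eq_zero fun j _ => ?_
    rw [if_neg]
    omega

lemma rocc_update (x : Config N) (k : Fin N) (b : Bool) :
    rocc (Function.update x k b) = Function.update (rocc x) (k + 1) (if b then 1 else 0) := by
  funext m
  simp only [rocc, ext_update, Function.update_apply]
  split_ifs <;> simp_all

lemma energy_update (κ : ℝ) (x : Config N) (k : Fin N) (b : Bool) :
    energy κ (Function.update x k b) = energy κ x -
      κ * (((if b then 1 else 0) - rocc x (k + 1)) * (rocc x k + rocc x (k + 2))) := by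
  rw [energy_eq, energy_eq, rocc_update, sum_mul_succ_update _ _ _ (by omega)]
  ring

lemma energy_swapConf (κ : ℝ) (x : Config N) (i j : Fin N) (hij : (j : ℕ) = i + 1) :
    energy κ (swapConf x i j) = energy κ x -
      κ * ((rocc x (i + 1) - rocc x (i + 2)) * (rocc x (i + 3) - rocc x i)) := by
  have hj : (if x j then 1 else 0 : ℝ) = rocc x (i + 2) := by
    rw [← ext_succ x j, hij, rocc]
  have hi : (if x i then 1 else 0 : ℝ) = rocc x (i + 1) := by
    rw [← ext_succ x i, rocc]
  rw [swapConf, energy_update, energy_update, rocc_update, hj, hi, hij]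
  simp only [Function.update_apply]
  simp
  ring

/-! ### Local description of the set `𝒫` -/

/-- Local form of membership in `𝒫` for an occupation function with sites numbered
from `1`. -/
structure IsLong (N : ℕ) (X : ℕ → Bool) : Prop where
  first : X 1 = true
  second : X 2 = true
  third : X 3 = true
  five_le : 5 ≤ N
  last : ∀ i, N ≤ i + 1 → X i = false
  down : ∀ i, 1 ≤ i → X i = true → X (i + 1) = false → 3 ≤ i ∧ X (i - 1) = true ∧
    X (i - 2) = true ∧ X (i + 2) = false ∧ X (i + 3) = false
  up : ∀ i, 1 ≤ i → X i = false → X (i + 1) = true → 3 ≤ i ∧ X (i - 1) = false ∧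
    X (i - 2) = false ∧ X (i + 2) = true ∧ X (i + 3) = true

lemma isLong_single (p q : ℕ) (hp : 3 ≤ p) (hq : 2 ≤ q) :
    IsLong (p + q) fun i => decide (i ≤ p) := by
  constructor <;> (try simp only [decide_eq_true_eq, decide_eq_false_iff_not]) <;> omega

lemma isLong_append (p q n : ℕ) (X Z : ℕ → Bool) (hp : 3 ≤ p) (hq : 3 ≤ q) (hX : IsLong n X)
    (hA : ∀ i, i ≤ p → Z i = true) (hB : ∀ i, p < i → i ≤ p + q → Z i = false)
    (hC : ∀ k, 1 ≤ k → Z (p + q + k) = X k) : IsLong (p + q + n) Z := by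
  obtain ⟨h1, h2, h3, h5, hl, hd, hu⟩ := hX
  refine ⟨hA 1 (by omega), hA 2 (by omega), hA 3 hp, by omega, fun i hi => ?_,
    fun i hi hi1 hi2 => ?_, fun i hi hi1 hi2 => ?_⟩
  · obtain ⟨k, rfl⟩ := Nat.exists_eq_add_of_le (show p + q ≤ i by omega)
    rw [hC k (by omega)]
    exact hl k (by omega)
  · rcases lt_or_ge p i with hpi | hpi
    · rcases le_or_gt i (p + q) with hi' | hi'
      · simp [hB i hpi hi'] at hi1
      · obtain ⟨k, rfl⟩ := Nat.exists_eq_add_of_le hi'.le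
        rw [hC k (by omega)] at hi1
        rw [add_assoc, hC (k + 1) (by omega)] at hi2
        obtain ⟨a, b, c, d, e⟩ := hd k (by omega) hi1 hi2
        rw [Nat.add_sub_assoc (by omega), Nat.add_sub_assoc (by omega), add_assoc _ k,
          add_assoc _ k, hC (k - 1) (by omega), hC (k - 2) (by omega), hC (k + 2) (by omega),
          hC (k + 3) (by omega)]
        exact ⟨by omega, b, c, d, e⟩
    · obtain rfl : i = p := by
        by_contra hne
        simp [hA (i + 1) (by omega)] at hi2
      exact ⟨hp, hA _ (by omega), hA _ (by omega), hB _ (by omega) (by omega),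
        hB _ (by omega) (by omega)⟩
  · rcases lt_or_ge (p + q) i with hpi | hpi
    · obtain ⟨k, rfl⟩ := Nat.exists_eq_add_of_le hpi.le
      rw [hC k (by omega)] at hi1
      rw [add_assoc, hC (k + 1) (by omega)] at hi2
      obtain ⟨a, b, c, d, e⟩ := hu k (by omega) hi1 hi2
      rw [Nat.add_sub_assoc (by omega), Nat.add_sub_assoc (by omega), add_assoc _ k,
        add_assoc _ k, hC (k - 1) (by omega), hC (k - 2) (by omega), hC (k + 2) (by omega),
        hC (k + 3) (by omega)]
      exact ⟨by omega, b, c, d, e⟩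
    · have hpi' : p < i := by
        by_contra hne
        simp [hA i (by omega)] at hi1
      obtain rfl : i = p + q := by
        by_contra hne
        simp [hB (i + 1) (by omega) (by omega)] at hi2
      exact ⟨by omega, hB _ (by omega) (by omega), hB _ (by omega) (by omega),
        (hC 2 (by omega)).trans h2, (hC 3 (by omega)).trans h3⟩

/-- The occupation function of a list of sites, numbered from `1`. -/
def listExt (l : List Bool) (i : ℕ) : Bool := l.getD (i - 1) false

lemma IsLong.congr {n : ℕ} {X Y : ℕ → Bool} (hX : IsLong n X) (h : ∀ i, 1 ≤ i → X i = Y i) :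
    IsLong n Y := by
  obtain ⟨h1, h2, h3, h5, hl, hd, hu⟩ := hX
  refine ⟨by rw [← h 1 (by omega), h1], by rw [← h 2 (by omega), h2],
    by rw [← h 3 (by omega), h3], h5, fun i hi => ?_, fun i hi hi1 hi2 => ?_,
    fun i hi hi1 hi2 => ?_⟩
  · rw [← h i (by omega), hl i hi]
  · rw [← h i hi] at hi1
    rw [← h (i + 1) (by omega)] at hi2
    have := hd i hi hi1 hi2
    rwa [← h (i - 1) (by omega), ← h (i - 2) (by omega), ← h (i + 2) (by omega),
      ← h (i + 3) (by omega)]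
  · rw [← h i hi] at hi1
    rw [← h (i + 1) (by omega)] at hi2
    have := hu i hi hi1 hi2
    rwa [← h (i - 1) (by omega), ← h (i - 2) (by omega), ← h (i + 2) (by omega),
      ← h (i + 3) (by omega)]

lemma isLong_blockConfig : ∀ ps qs : List ℕ, ps.length = qs.length → 0 < ps.length →
    (∀ p ∈ ps, 3 ≤ p) → (∀ q ∈ qs.dropLast, 3 ≤ q) → (∀ q ∈ qs.getLast?, 2 ≤ q) →
    IsLong (blockConfig ps qs).length (listExt (blockConfig ps qs))
  | [], _, _, h, _, _, _ => by simp at h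
  | _ :: _, [], h, _, _, _, _ => by simp at h
  | [p], [q], _, _, hp, _, hq => by
    have hL : (blockConfig [p] [q]).length = p + q := by simp [blockConfig]
    rw [hL]
    refine (isLong_single p q (hp p (by simp)) (hq q (by simp))).congr fun i hi => ?_
    simp only [listExt, blockConfig, List.zip_cons_cons, List.zip_nil_right, List.flatMap_cons,
      List.flatMap_nil, List.append_nil]
    grind
  | [_], _ :: _ :: _, h, _, _, _, _ => by simp at h
  | _ :: _ :: _, [_], h, _, _, _, _ => by simp at h
  | p :: p' :: ps, q :: q' :: qs, h, _, hp, hq, hq' => by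
    have ih := isLong_blockConfig (p' :: ps) (q' :: qs) (by simpa using h) (by simp)
      (fun r hr => hp r (List.mem_cons_of_mem _ hr))
      (fun r hr => hq r (by rw [List.dropLast_cons_cons]; exact List.mem_cons_of_mem _ hr))
      (fun r hr => hq' r (by rwa [List.getLast?_cons_cons]))
    have hb : blockConfig (p :: p' :: ps) (q :: q' :: qs) =
        List.replicate p true ++ List.replicate q false ++ blockConfig (p' :: ps) (q' :: qs) :=
      rfl
    rw [hb]
    generalize blockConfig (p' :: ps) (q' :: qs) = l at ih
    have hL : (List.replicate p true ++ List.replicate q false ++ l).length =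
        p + q + l.length := by simp [add_assoc]
    rw [hL]
    have hp3 := hp p (by simp)
    have hq3 := hq q (by simp)
    clear hp hq hq' hb hL h
    refine isLong_append p q _ _ _ hp3 hq3 ih ?_ ?_ ?_ <;> simp only [listExt] <;> grind

lemma memP.isLong {x : Config N} (hx : memP x) : IsLong N (ext x) := by
  obtain ⟨ps, qs, h1, h2, h3, h4, h5, h6⟩ := hx
  have h := isLong_blockConfig ps qs h1 h2 h3 h4 h5
  rw [← h6, List.length_ofFn] at h
  refine h.congr fun i hi => ?_
  obtain ⟨m, rfl⟩ := Nat.exists_eq_succ_of_ne_zero (by omega : i ≠ 0)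
  by_cases hm : m < N <;> simp [listExt, ext, hm]

lemma IsLong.alternating_unique {X Y : ℕ → Bool} (hX : IsLong N X) {i k : ℕ}
    (hi : X (i + 1) ≠ X (i + 2))
    (hY : ∀ m, Y m = if m = i + 1 then X (i + 2) else if m = i + 2 then X (i + 1) else X m)
    (h1 : Y k = Y (k + 2)) (h2 : Y (k + 1) = Y (k + 3)) (h3 : Y k ≠ Y (k + 1)) : k = i := by
  have hd := hX.down
  have hu := hX.up
  have near : 2 ≤ i ∧ X i = X (i + 1) ∧ X (i - 1) = X (i + 1) ∧ X (i + 3) = X (i + 2) ∧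
      X (i + 4) = X (i + 2) := by
    cases ha : X (i + 1) <;> cases hb : X (i + 2)
    · simp [ha, hb] at hi
    · obtain ⟨a, b, c, d, e⟩ := hu (i + 1) (by omega) ha hb
      exact ⟨by omega, b, c, d, e⟩
    · obtain ⟨a, b, c, d, e⟩ := hd (i + 1) (by omega) ha hb
      exact ⟨by omega, b, c, d, e⟩
    · simp [ha, hb] at hi
  obtain ⟨n0, n1, n2, n3, n4⟩ := near
  by_contra hne
  by_cases hfar : k + 4 ≤ i ∨ i + 3 ≤ k
  · rw [hY k, hY (k + 2), if_neg (by omega), if_neg (by omega), if_neg (by omega),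
      if_neg (by omega)] at h1
    rw [hY k, hY (k + 1), if_neg (by omega), if_neg (by omega), if_neg (by omega),
      if_neg (by omega)] at h3
    cases ha : X (k + 1)
    · have := hu (k + 1) (by omega) ha (by rw [← h1]; simpa [ha] using h3)
      simp_all
    · have := hd (k + 1) (by omega) ha (by rw [← h1]; simpa [ha] using h3)
      simp_all
  · have y1 := hY (i - 1)
    have y2 := hY i
    have y3 := hY (i + 3)
    have y4 := hY (i + 4)
    rw [if_neg (by omega), if_neg (by omega)] at y1 y2 y3 y4
    obtain hk | hk | hk | hk | hk : k + 1 = i - 1 - 1 ∨ k + 1 = i - 1 ∨ k + 1 = i ∨ k = i + 1 ∨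
      k = i + 2 := by omega
    · have e1 : k + 2 = i - 1 := by omega
      have e2 : k + 3 = i := by omega
      rw [e1] at h1; rw [e2] at h2
      exact h3 (by rw [h1, h2, y1, y2, n1, n2])
    · have e2 : k + 2 = i := by omega
      rw [e2] at h1; rw [hk] at h3
      exact h3 (by rw [h1, y1, y2, n1, n2])
    · have e1 : k = i - 1 := by omega
      rw [hk, e1] at h3
      exact h3 (by rw [y1, y2, n1, n2])
    · subst hk
      exact h3 (by rw [h1, h2, y3, y4, n3, n4])
    · subst hk
      exact h3 (by rw [h1, y3, y4, n3, n4])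

lemma rocc_alternating (x : Config N) (k : ℕ)
    (h : ¬ (ext x k = ext x (k + 2) ∧ ext x (k + 1) = ext x (k + 3) ∧
      ext x k ≠ ext x (k + 1))) :
    (rocc x (k + 1) - rocc x (k + 2)) * (rocc x (k + 3) - rocc x k) ≤ 0 := by
  simp only [rocc]
  cases h0 : ext x k <;> cases h1 : ext x (k + 1) <;> cases h2 : ext x (k + 2) <;>
    cases h3 : ext x (k + 3) <;> simp_all

lemma exists_swap_of_isLong {x : Config N} (hx : IsLong N (ext x)) :
    ∃ i j : Fin N, (j : ℕ) = i + 1 ∧ ext x (i + 1) ≠ ext x (i + 2) := by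
  by_contra! hcon
  have key : ∀ m, m < N → ext x (m + 1) = true := by
    intro m
    induction m with
    | zero => exact fun _ => hx.first
    | succ m ih =>
      intro hm
      exact (hcon ⟨m, by omega⟩ ⟨m + 1, hm⟩ rfl).symm.trans (ih (by omega))
  have h5 := hx.five_le
  have h1 := key (N - 1) (by omega)
  rw [hx.last _ (by omega)] at h1
  exact Bool.false_ne_true h1

/-! ### Transition exponents -/

lemma flipConf_apply_ne (x : Config N) {i k : Fin N} : flipConf x k i ≠ x i ↔ i = k := by
  by_cases h : i = k
  · subst h; simp [flipConf]
  · simp [flipConf, h]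

lemma not_isSwap_flipConf (x : Config N) (k : Fin N) : ¬ IsSwap x (flipConf x k) := by
  rintro ⟨i, j, hij, h⟩
  have hne : i ≠ j := by rintro rfl; omega
  have hi : flipConf x k i = x j := by rw [h]; simp [swapConf, hne]
  have hj : flipConf x k j = x i := by rw [h]; simp [swapConf]
  by_cases hx : x i = x j
  · have hk : flipConf x k k = x k := by
      rw [h, swapConf, hx, ← hx, Function.update_eq_self, hx, Function.update_eq_self]
    exact flipConf_apply_ne x |>.2 rfl hk
  · have h1 := (flipConf_apply_ne x (i := i) (k := k)).1 (by rw [hi]; exact Ne.symm hx)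
    have h2 := (flipConf_apply_ne x (i := j) (k := k)).1 (by rw [hj]; exact hx)
    exact hne (h1.trans h2.symm)

variable [NeZero N]

lemma phi_swapConf (κ μL μR : ℝ) (x : Config N) (i j : Fin N) (hij : (j : ℕ) = i + 1) :
    phi κ μL μR x (swapConf x i j) =
      κ / 2 * ((rocc x (i + 1) - rocc x (i + 2)) * (rocc x (i + 3) - rocc x i)) := by
  rw [phi, if_pos ⟨i, j, hij, rfl⟩, energy_swapConf κ x i j hij]
  ring

lemma phi_flipConf_zero (κ μL μR : ℝ) (x : Config N) :
    phi κ μL μR x (flipConf x 0) = (1 - 2 * rocc x 1) * (μL + κ * rocc x 2) / 2 := by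
  have h0 : rocc x 0 = 0 := by simp [rocc, ext]
  have h1 : rocc x 1 = occ x 0 := by
    rw [rocc, occ]; congr 2; exact ext_succ x 0
  have h2 : (if !x 0 then 1 else 0 : ℝ) = 1 - occ x 0 := by
    cases h : x 0 <;> simp [occ, h]
  rw [phi, if_neg (not_isSwap_flipConf x 0), if_pos rfl, flipConf, energy_update, h2]
  simp only [Fin.val_zero, zero_add, h0, h1]
  ring

lemma phi_flipConf_last (hN : 2 ≤ N) (κ μL μR : ℝ) (x : Config N) :
    phi κ μL μR x (flipConf x (lastIdx N)) =
      (1 - 2 * rocc x N) * (μR + κ * rocc x (N - 1)) / 2 := by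
  have hl : ((lastIdx N : Fin N) : ℕ) = N - 1 := rfl
  have h0 : rocc x (N - 1 + 2) = 0 := by
    rw [rocc, ext_of_lt x (by omega)]; simp
  have h1 : rocc x N = occ x (lastIdx N) := by
    rw [rocc, occ, ← ext_succ x (lastIdx N), hl, show N - 1 + 1 = N by omega]
  have h2 : (if !x (lastIdx N) then 1 else 0 : ℝ) = 1 - occ x (lastIdx N) := by
    cases h : x (lastIdx N) <;> simp [occ, h]
  have hne : flipConf x (lastIdx N) ≠ flipConf x 0 := by
    intro h
    have := (flipConf_apply_ne x (i := lastIdx N) (k := 0)).1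
      (by rw [← h]; exact (flipConf_apply_ne x).2 rfl)
    have := congrArg Fin.val this
    rw [hl, Fin.val_zero] at this
    omega
  rw [phi, if_neg (not_isSwap_flipConf x _), if_neg hne, if_pos rfl, flipConf, energy_update, h2,
    hl, h0, show N - 1 + 1 = N by omega, h1]
  ring

/-! ### Preferred steps and costs -/

section Costs

variable (κ μL μR : ℝ)

lemma Ucost_nonneg {x y : Config N} (h : Allowed x y) : 0 ≤ Ucost κ μL μR x y := by
  have : phi κ μL μR x y ≤ sSup (phi κ μL μR x '' {y | Allowed x y}) :=
    le_csSup (Set.toFinite _).bddAbove ⟨y, h, rfl⟩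
  rw [Ucost, Gam]
  linarith

lemma preferredStep_iff {x y : Config N} : PreferredStep κ μL μR x y ↔
    Allowed x y ∧ ∀ z, Allowed x z → phi κ μL μR x z ≤ phi κ μL μR x y := by
  refine and_congr_right fun hxy => ?_
  have hU : Ucost κ μL μR x y = 0 ↔
      phi κ μL μR x y = sSup (phi κ μL μR x '' {y | Allowed x y}) := by
    rw [Ucost, Gam]
    constructor <;> intro h <;> linarith
  rw [hU]
  constructor
  · intro h z hz
    rw [h]
    exact le_csSup (Set.toFinite _).bddAbove ⟨z, hz, rfl⟩
  · intro h
    have hmax : IsGreatest (phi κ μL μR x '' {y | Allowed x y}) (phi κ μL μR x y) := by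
      refine ⟨⟨y, hxy, rfl⟩, ?_⟩
      rintro _ ⟨z, hz, rfl⟩
      exact h z hz
    exact hmax.csSup_eq.symm

lemma pathCost_nonneg : ∀ L : List (Config N), L.IsChain Allowed → 0 ≤ pathCost κ μL μR L
  | [], _ => le_rfl
  | [_], _ => le_rfl
  | a :: b :: l, h => by
    rw [List.isChain_cons_cons] at h
    exact add_nonneg (Ucost_nonneg κ μL μR h.1) (pathCost_nonneg _ h.2)

lemma Ucal_eq_zero {x y : Config N} (L : List (Config N)) (hL : L.IsChain Allowed)
    (hx : L.head? = some x) (hy : L.getLast? = some y) (h0 : pathCost κ μL μR L = 0) :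
    Ucal κ μL μR x y = 0 := by
  refine le_antisymm (csInf_le ⟨0, ?_⟩ ⟨L, hL, hx, hy, h0.symm⟩) (Real.sInf_nonneg ?_) <;>
  · rintro _ ⟨L, hL, -, -, rfl⟩
    exact pathCost_nonneg κ μL μR L hL

lemma le_pathCost {A : Set (Config N)} {δ : ℝ}
    (hδ : ∀ a ∈ A, ∀ b, b ∉ A → Allowed a b → δ ≤ Ucost κ μL μR a b) :
    ∀ (L : List (Config N)) (x y : Config N), L.IsChain Allowed → L.head? = some x →
      L.getLast? = some y → x ∈ A → y ∉ A → δ ≤ pathCost κ μL μR L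
  | [], _, _, _, h, _, _, _ => by simp at h
  | [a], x, y, _, h, h', hx, hy => by
    simp only [List.head?_cons, Option.some.injEq, List.getLast?_singleton] at h h'
    exact absurd (h' ▸ h ▸ hx) hy
  | a :: b :: l, x, y, hc, h, h', hx, hy => by
    rw [List.isChain_cons_cons] at hc
    simp only [List.head?_cons, Option.some.injEq] at h
    subst h
    rw [List.getLast?_cons_cons] at h'
    rw [pathCost]
    by_cases hb : b ∈ A
    · have := le_pathCost hδ (b :: l) b y hc.2 rfl h' hb hy
      linarith [Ucost_nonneg κ μL μR hc.1]
    · linarith [hδ a hx b hb hc.1, pathCost_nonneg κ μL μR _ hc.2]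

end Costs

/-! ### Irreducibility -/

lemma reachable_of_isSwap {x y : Config N} (h : IsSwap x y) :
    Relation.ReflTransGen Allowed x y := by
  by_cases hxy : y = x
  · rw [hxy]
  · exact .single ⟨hxy, .inl h⟩

lemma reachable_flipConf (k : ℕ) (hk : k < N) (x : Config N) :
    Relation.ReflTransGen Allowed x (flipConf x ⟨k, hk⟩) := by
  induction k generalizing x with
  | zero =>
    refine .single ⟨fun h => ?_, .inr (.inl rfl)⟩
    exact (flipConf_apply_ne x (i := ⟨0, hk⟩) (k := ⟨0, hk⟩)).2 rfl (congrFun h _)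
  | succ k ih =>
    have hk' : k < N := by omega
    have hne : (⟨k, hk'⟩ : Fin N) ≠ ⟨k + 1, hk⟩ := by simp
    by_cases hx : x ⟨k, hk'⟩ = x ⟨k + 1, hk⟩
    · refine (ih hk' x).trans (reachable_of_isSwap ⟨⟨k, hk'⟩, ⟨k + 1, hk⟩, rfl, ?_⟩)
      funext m
      simp only [flipConf, swapConf, Function.update_apply]
      split_ifs <;> simp_all
    · have h1 : IsSwap x (swapConf x ⟨k, hk'⟩ ⟨k + 1, hk⟩) := ⟨_, _, rfl, rfl⟩
      refine (reachable_of_isSwap h1).trans ?_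
      convert ih hk' (swapConf x ⟨k, hk'⟩ ⟨k + 1, hk⟩) using 1
      funext m
      simp only [flipConf, swapConf, Function.update_apply]
      have : x ⟨k + 1, hk⟩ = !x ⟨k, hk'⟩ := by
        cases h : x ⟨k, hk'⟩ <;> cases h' : x ⟨k + 1, hk⟩ <;> simp_all
      split_ifs <;> simp_all

lemma reachable (x y : Config N) : Relation.ReflTransGen Allowed x y := by
  have key : ∀ (s : Finset (Fin N)) (x : Config N), (∀ i, i ∉ s → x i = y i) →
      Relation.ReflTransGen Allowed x y := by
    intro s
    induction s using Finset.induction_on with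
    | empty =>
      intro x h
      rw [show x = y from funext fun i => h i (by simp)]
    | insert a s _ ih =>
      intro x h
      by_cases ha : x a = y a
      · refine ih x fun i hi => ?_
        by_cases hia : i = a
        · rw [hia, ha]
        · exact h i (by simp [hi, hia])
      · refine (reachable_flipConf a a.2 x).trans (ih _ fun i hi => ?_)
        by_cases hia : i = a
        · subst hia
          cases h1 : x i <;> cases h2 : y i <;> simp_all [flipConf]
        · rw [flipConf, Function.update_of_ne hia]
          exact h i (by simp [hi, hia])
  exact key Finset.univ x (by simp)

lemma exists_path (x y : Config N) : ∃ L : List (Config N), L.IsChain Allowed ∧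
    L.head? = some x ∧ L.getLast? = some y := by
  induction reachable x y using Relation.ReflTransGen.head_induction_on with
  | refl => exact ⟨[y], by simp, rfl, rfl⟩
  | head hab _ ih =>
    obtain ⟨L, hc, hh, hl⟩ := ih
    rename_i a b _
    cases L with
    | nil => simp at hh
    | cons c l =>
      simp only [List.head?_cons, Option.some.injEq] at hh
      subst hh
      exact ⟨a :: c :: l, List.isChain_cons_cons.2 ⟨hab, hc⟩, rfl, by
        rw [List.getLast?_cons_cons, hl]⟩

/-! ### Transitions out of `𝒫` and out of the successors of `𝒫` -/

section Successors

lemma Allowed.cases {x z : Config N} (h : Allowed x z) :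
    (∃ i j : Fin N, (j : ℕ) = i + 1 ∧ ext x (i + 1) ≠ ext x (i + 2) ∧ z = swapConf x i j) ∨
      z = flipConf x 0 ∨ z = flipConf x (lastIdx N) := by
  obtain ⟨hne, ⟨i, j, hij, rfl⟩ | h⟩ := h
  · exact .inl ⟨i, j, hij, fun he => hne (swapConf_eq_self hij he), rfl⟩
  · exact .inr h

lemma allowed_swapConf {x : Config N} {i j : Fin N} (hij : (j : ℕ) = i + 1)
    (h : ext x (i + 1) ≠ ext x (i + 2)) : Allowed x (swapConf x i j) := by
  refine ⟨fun he => h ?_, .inl ⟨i, j, hij, rfl⟩⟩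
  have := ext_swapConf x i j hij (i + 1)
  rwa [he, if_pos rfl] at this

variable {κ μL μR : ℝ}

lemma phi_swapConf_of_isLong {x : Config N} (hx : IsLong N (ext x)) {i j : Fin N}
    (hij : (j : ℕ) = i + 1) (h : ext x (i + 1) ≠ ext x (i + 2)) :
    phi κ μL μR x (swapConf x i j) = -κ / 2 := by
  rw [phi_swapConf κ μL μR x i j hij]
  cases ha : ext x (i + 1) <;> cases hb : ext x (i + 2)
  · simp [ha, hb] at h
  · obtain ⟨-, b, -, d, -⟩ := hx.up (i + 1) (by omega) ha hb
    have b' : ext x i = false := b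
    have d' : ext x (i + 3) = true := d
    simp [rocc, ha, hb, b', d']
    ring
  · obtain ⟨-, b, -, d, -⟩ := hx.down (i + 1) (by omega) ha hb
    have b' : ext x i = true := b
    have d' : ext x (i + 3) = false := d
    simp [rocc, ha, hb, b', d']
    ring
  · simp [ha, hb] at h

lemma phi_flipConf_of_isLong (hμL : 0 < μL) (hμR : κ < -μR) {x z : Config N}
    (hx : IsLong N (ext x)) (hz : z = flipConf x 0 ∨ z = flipConf x (lastIdx N)) :
    phi κ μL μR x z < -κ / 2 := by
  have h5 := hx.five_le
  rcases hz with rfl | rfl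
  · rw [phi_flipConf_zero, rocc, rocc, hx.first, hx.second]
    simp only [if_true]
    linarith
  · rw [phi_flipConf_last (by omega), rocc, rocc, hx.last N (by omega),
      hx.last (N - 1) (by omega)]
    simp only [Bool.false_eq_true, if_false]
    linarith

lemma preferredStep_iff_of_isLong (hμL : 0 < μL) (hμR : κ < -μR) {x y : Config N}
    (hx : IsLong N (ext x)) : PreferredStep κ μL μR x y ↔
      ∃ i j : Fin N, (j : ℕ) = i + 1 ∧ ext x (i + 1) ≠ ext x (i + 2) ∧ y = swapConf x i j := by
  rw [preferredStep_iff]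
  constructor
  · rintro ⟨hxy, hmax⟩
    rcases hxy.cases with h | h
    · exact h
    · obtain ⟨i, j, hij, hne⟩ := exists_swap_of_isLong hx
      have h1 := hmax _ (allowed_swapConf hij hne)
      rw [phi_swapConf_of_isLong hx hij hne] at h1
      linarith [phi_flipConf_of_isLong hμL hμR hx h]
  · rintro ⟨i, j, hij, hne, rfl⟩
    refine ⟨allowed_swapConf hij hne, fun z hz => ?_⟩
    rw [phi_swapConf_of_isLong hx hij hne]
    rcases hz.cases with ⟨k, l, hkl, hne', rfl⟩ | h
    · rw [phi_swapConf_of_isLong hx hkl hne']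
    · exact (phi_flipConf_of_isLong hμL hμR hx h).le

lemma phi_swapConf_symm (x : Config N) {i j : Fin N} (hij : (j : ℕ) = i + 1) :
    phi κ μL μR (swapConf x i j) x = -phi κ μL μR x (swapConf x i j) := by
  have h1 : IsSwap (swapConf x i j) x := ⟨i, j, hij, (swapConf_swapConf x hij).symm⟩
  rw [phi, phi, if_pos h1, if_pos ⟨i, j, hij, rfl⟩]
  ring

lemma phi_le_zero_of_successor (hκ : 0 < κ) (hμL : 0 < μL) (hμR : κ < -μR) {x z : Config N}
    (hx : IsLong N (ext x)) {i j : Fin N} (hij : (j : ℕ) = i + 1)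
    (hne : ext x (i + 1) ≠ ext x (i + 2)) (hz : Allowed (swapConf x i j) z) (hzx : z ≠ x) :
    phi κ μL μR (swapConf x i j) z ≤ 0 := by
  have h5 := hx.five_le
  have hY := ext_swapConf x i j hij
  have hocc : ∀ m, 0 ≤ rocc (swapConf x i j) m ∧ rocc (swapConf x i j) m ≤ 1 := by
    intro m
    rw [rocc]
    split_ifs <;> norm_num
  rcases hz.cases with ⟨k, l, hkl, -, rfl⟩ | rfl | rfl
  · rw [phi_swapConf κ μL μR _ k l hkl]
    refine mul_nonpos_of_nonneg_of_nonpos (by linarith) (rocc_alternating _ _ ?_)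
    rintro ⟨h1, h2, h3⟩
    obtain rfl : k = i := Fin.ext (hx.alternating_unique hne hY h1 h2 h3)
    obtain rfl : l = j := Fin.ext (hkl.trans hij.symm)
    exact hzx (swapConf_swapConf x hij)
  · have h1 : ext (swapConf x i j) 1 = true := by
      have hi : (i : ℕ) ≠ 0 := fun h => hne (by simp [h, hx.first, hx.second])
      rw [hY, if_neg (by omega), if_neg (by omega), hx.first]
    rw [phi_flipConf_zero, rocc, h1, if_pos rfl]
    nlinarith [mul_nonneg hκ.le (hocc 2).1]
  · have h1 : ext (swapConf x i j) N = false := by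
      have hj := j.2
      have hi : (i : ℕ) + 2 ≠ N := fun h =>
        hne (by rw [hx.last _ (by omega), hx.last _ (by omega)])
      rw [hY, if_neg (by omega), if_neg (by omega), hx.last N (by omega)]
    rw [phi_flipConf_last (by omega), rocc, h1]
    simp only [Bool.false_eq_true, if_false]
    nlinarith [mul_le_mul_of_nonneg_left (hocc (N - 1)).2 hκ.le]

lemma phi_pos_of_preferredStep (hκ : 0 < κ) (hμL : 0 < μL) (hμR : κ < -μR) {x y : Config N}
    (hx : IsLong N (ext x)) (h : PreferredStep κ μL μR x y) : 0 < phi κ μL μR y x := by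
  obtain ⟨i, j, hij, hne, rfl⟩ := (preferredStep_iff_of_isLong hμL hμR hx).1 h
  rw [phi_swapConf_symm x hij, phi_swapConf_of_isLong hx hij hne]
  linarith

lemma phi_neg_of_preferredStep (hκ : 0 < κ) (hμL : 0 < μL) (hμR : κ < -μR) {x y : Config N}
    (hx : IsLong N (ext x)) (h : PreferredStep κ μL μR x y) : phi κ μL μR x y < 0 := by
  obtain ⟨i, j, hij, hne, rfl⟩ := (preferredStep_iff_of_isLong hμL hμR hx).1 h
  rw [phi_swapConf_of_isLong hx hij hne]
  linarith

/-- The only preferred successor of a preferred successor of `x ∈ 𝒫` is `x` itself. -/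
lemma preferredStep_successor_iff (hκ : 0 < κ) (hμL : 0 < μL) (hμR : κ < -μR)
    {x y z : Config N} (hx : IsLong N (ext x)) (h : PreferredStep κ μL μR x y) :
    PreferredStep κ μL μR y z ↔ z = x := by
  have hpos := phi_pos_of_preferredStep hκ hμL hμR hx h
  obtain ⟨i, j, hij, hne, rfl⟩ := (preferredStep_iff_of_isLong hμL hμR hx).1 h
  have hback : Allowed (swapConf x i j) x :=
    ⟨h.1.1.symm, .inl ⟨i, j, hij, (swapConf_swapConf x hij).symm⟩⟩
  rw [preferredStep_iff]
  constructor
  · rintro ⟨hz, hmax⟩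
    by_contra hzx
    linarith [hmax x hback, phi_le_zero_of_successor hκ hμL hμR hx hij hne hz hzx]
  · rintro rfl
    refine ⟨hback, fun w hw => ?_⟩
    by_cases hwz : w = z
    · rw [hwz]
    · exact (phi_le_zero_of_successor hκ hμL hμR hx hij hne hw hwz).trans hpos.le

end Successors

/-! ### Attractors -/

section Attractors

variable {κ μL μR : ℝ}

lemma Ucal_pos {A : Set (Config N)}
    (hA : ∀ a ∈ A, ∀ b, PreferredStep κ μL μR a b → b ∈ A) {x y : Config N} (hx : x ∈ A)
    (hy : y ∉ A) : 0 < Ucal κ μL μR x y := by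
  have hδ : ∃ δ > 0, ∀ a ∈ A, ∀ b, b ∉ A → Allowed a b → δ ≤ Ucost κ μL μR a b := by
    let S : Set (Config N × Config N) := {p | p.1 ∈ A ∧ p.2 ∉ A ∧ Allowed p.1 p.2}
    by_cases hS : S.Nonempty
    · obtain ⟨p, ⟨hp, hp', hpa⟩, hmin⟩ :=
        Set.exists_min_image S (fun p => Ucost κ μL μR p.1 p.2) S.toFinite hS
      refine ⟨Ucost κ μL μR p.1 p.2, ?_, fun a ha b hb hab => hmin (a, b) ⟨ha, hb, hab⟩⟩
      exact (Ucost_nonneg κ μL μR hpa).lt_of_ne' fun h0 => hp' (hA _ hp _ ⟨hpa, h0⟩)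
    · exact ⟨1, one_pos, fun a ha b hb hab => absurd ⟨(a, b), ha, hb, hab⟩ hS⟩
  obtain ⟨δ, hδ0, hδ⟩ := hδ
  obtain ⟨L, hc, hh, hl⟩ := exists_path x y
  refine hδ0.trans_le (le_csInf ⟨_, L, hc, hh, hl, rfl⟩ ?_)
  rintro _ ⟨L, hc, hh, hl, rfl⟩
  exact le_pathCost κ μL μR hδ L x y hc hh hl hx hy

lemma isAttractor_Attr {x : Config N}
    (h : ∀ y z, PreferredStep κ μL μR x y → (PreferredStep κ μL μR y z ↔ z = x)) :
    IsAttractor κ μL μR (Attr κ μL μR x) := by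
  refine ⟨⟨x, Set.mem_insert _ _⟩, ?_, fun a ha b hb => Ucal_pos ?_ ha hb⟩
  · rintro a (rfl | ha) b (rfl | hb) hab
    · exact absurd rfl hab
    · exact Ucal_eq_zero κ μL μR [a, b] (by simp [hb.1]) rfl rfl (by simp [pathCost, hb.2])
    · have hax := (h a b ha).2 rfl
      exact Ucal_eq_zero κ μL μR [a, b] (by simp [hax.1]) rfl rfl (by simp [pathCost, hax.2])
    · have hax := (h a x ha).2 rfl
      exact Ucal_eq_zero κ μL μR [a, x, b] (by simp [hax.1, hb.1]) rfl rfl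
        (by simp [pathCost, hax.2, hb.2])
  · rintro a (rfl | ha) b hab
    · exact .inr hab
    · exact .inl ((h a b ha).1 hab)

end Attractors

end Kawasaki


open Kawasaki in
/-- for `μ_L > κ > 0 > μ_R`, `|μ_R| > κ`: for every `x ∈ 𝒫` the set `𝒜_x`
of `x` together with its preferred successors is an attractor, and distinct `x, y ∈ 𝒫`
give disjoint attractors. -/
theorem statement6 (N : ℕ) [NeZero N] (hN : 5 ≤ N) (κ μL μR : ℝ)
    (hκ : 0 < κ) (hμL : κ < μL) (hμR : μR < 0) (hμRκ : κ < |μR|) :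
    (∀ x : Config N, memP x → IsAttractor κ μL μR (Attr κ μL μR x)) ∧
    (∀ x y : Config N, memP x → memP y → x ≠ y →
      Attr κ μL μR x ∩ Attr κ μL μR y = ∅) := by
  have hμL0 : 0 < μL := hκ.trans hμL
  rw [abs_of_neg hμR] at hμRκ
  refine ⟨fun x hx => isAttractor_Attr fun y z h =>
    preferredStep_successor_iff hκ hμL0 hμRκ hx.isLong h, fun x y hx hy hxy => ?_⟩
  rw [Set.eq_empty_iff_forall_notMem]
  rintro z ⟨rfl | hxz, rfl | hyz⟩
  · exact hxy rfl
  · have h := (preferredStep_successor_iff hκ hμL0 hμRκ hy.isLong hyz).2 rfl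
    exact lt_asymm (phi_pos_of_preferredStep hκ hμL0 hμRκ hy.isLong hyz)
      (phi_neg_of_preferredStep hκ hμL0 hμRκ hx.isLong h)
  · have h := (preferredStep_successor_iff hκ hμL0 hμRκ hx.isLong hxz).2 rfl
    exact lt_asymm (phi_pos_of_preferredStep hκ hμL0 hμRκ hx.isLong hxz)
      (phi_neg_of_preferredStep hκ hμL0 hμRκ hy.isLong h)
  · have h := (preferredStep_successor_iff hκ hμL0 hμRκ hx.isLong hxz).2 rfl
    exact hxy ((preferredStep_successor_iff hκ hμL0 hμRκ hy.isLong hyz).1 h)
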